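/- Let A be a finite-dimensional simple algebra over F that is not a division algebra. Then A is 2-zpd if and only if A is separable over F. -/

import Mathlib

def IsZpd (F A : Type*) [Field F] [Ring A] [Algebra F A] : Prop :=
  ∀ φ : A →ₗ[F] A →ₗ[F] F, (∀ x y : A, x * y = 0 → φ x y = 0) →
    ∃ τ : A →ₗ[F] F, ∀ x y : A, φ x y = τ (x * y)

def Is2Zpd (F A : Type*) [Field F] [Ring A] [Algebra F A] : Prop :=
  ∀ φ : A →ₗ[F] A →ₗ[F] F, (∀ x y : A, x * y = 0 → y * x = 0 → φ x y = 0) →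
    ∃ τ₁ τ₂ : A →ₗ[F] F, ∀ x y : A, φ x y = τ₁ (x * y) + τ₂ (y * x)

def IsZLpd (F A : Type*) [Field F] [Ring A] [Algebra F A] : Prop :=
  ∀ φ : A →ₗ[F] A →ₗ[F] F, (∀ x y : A, x * y = y * x → φ x y = 0) →
    ∃ τ : A →ₗ[F] F, ∀ x y : A, φ x y = τ (x * y - y * x)

open TensorProduct in
def IsSeparableAlg (F A : Type*) [Field F] [Ring A] [Algebra F A] : Prop :=
  ∃ (m : ℕ) (p q : Fin m → A), ∑ i, p i * q i = 1 ∧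
    ∀ x : A, ∑ i, (x * p i) ⊗ₜ[F] q i = ∑ i, p i ⊗ₜ[F] (q i * x)

open TensorProduct

namespace TwoZpd

/-- A convenient form of simplicity. -/
lemma sandwich {A : Type*} [Ring A] [IsSimpleRing A] (S : AddSubgroup A) (u v p : A) (hp : p ≠ 0)
    (h : ∀ x y, u * x * p * y * v ∈ S) (x : A) : u * x * v ∈ S := by
  let J : TwoSidedIdeal A := TwoSidedIdeal.mk' {a | ∀ x y, u * x * a * y * v ∈ S}
    (by intro x y; simp)
    (by
      intro a b ha hb x y
      have := S.add_mem (ha x y) (hb x y)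
      simpa [mul_add, add_mul] using this)
    (by
      intro a ha x y
      have := S.neg_mem (ha x y)
      simpa using this)
    (by
      intro a b hb x y
      have := hb (x * a) y
      simpa [mul_assoc] using this)
    (by
      intro a b ha x y
      have := ha x (b * y)
      simpa [mul_assoc] using this)
  have hJ : p ∈ J := by
    rw [TwoSidedIdeal.mem_mk']
    exact h
  have h1 := IsSimpleRing.one_mem_of_ne_zero_mem J hp hJ
  rw [TwoSidedIdeal.mem_mk'] at h1
  simpa using h1 x 1

lemma exists_idem (F A : Type*) [Field F] [Ring A]
    [Algebra F A] [IsSimpleRing A] [FiniteDimensional F A]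
    (hnd : ∃ a : A, a ≠ 0 ∧ ¬ IsUnit a) : ∃ e : A, e * e = e ∧ e ≠ 0 ∧ 1 - e ≠ 0 := by
  have := IsArtinianRing.of_finite F A
  obtain ⟨n, hn, D, _, ⟨g⟩⟩ := IsSimpleRing.exists_ringEquiv_matrix_divisionRing A
  obtain ⟨a, ha, hu⟩ := hnd
  by_cases h1 : n = 1
  · subst h1
    exfalso
    apply hu
    have h2 : g a ≠ 0 := by simpa using ha
    have h3 : g a 0 0 ≠ 0 := by
      intro h
      apply h2
      ext i j
      rw [Subsingleton.elim i 0, Subsingleton.elim j 0, h]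
      rfl
    have h4 : IsUnit (g a) := by
      rw [isUnit_iff_exists]
      refine ⟨Matrix.of fun _ _ => (g a 0 0)⁻¹, ?_, ?_⟩
      · ext i j
        rw [Subsingleton.elim i 0, Subsingleton.elim j 0]
        rw [Matrix.mul_apply, Fin.sum_univ_one]
        simp [h3]
      · ext i j
        rw [Subsingleton.elim i 0, Subsingleton.elim j 0]
        rw [Matrix.mul_apply, Fin.sum_univ_one]
        simp [h3]
    simpa using h4
  · have hn0 : n ≠ 0 := hn.out
    let i0 : Fin n := ⟨0, by omega⟩
    let i1 : Fin n := ⟨1, by omega⟩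
    have h01 : i0 ≠ i1 := by simp [i0, i1, Fin.ext_iff]
    refine ⟨g.symm (Matrix.single i0 i0 1), ?_, ?_, ?_⟩
    · rw [← map_mul]; simp
    · simp only [ne_eq, EmbeddingLike.map_eq_zero_iff]
      intro h
      have := congrFun (congrFun h i0) i0
      simp at this
    · intro h
      have h' : (1 : Matrix (Fin n) (Fin n) D) - Matrix.single i0 i0 1 = 0 := by
        have := congrArg g h
        simpa using this
      have := congrFun (congrFun h' i1) i1
      simp [Matrix.single, h01] at this

lemma zpd {F A : Type*} [Field F] [Ring A]
    [Algebra F A] [IsSimpleRing A] [FiniteDimensional F A]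
    (hnd : ∃ a : A, a ≠ 0 ∧ ¬ IsUnit a) (φ : A →ₗ[F] A →ₗ[F] F)
    (h : ∀ x y : A, x * y = 0 → φ x y = 0) (a y : A) : φ a y = φ 1 (a * y) := by
  obtain ⟨e, he, he0, hf0⟩ := exists_idem F A hnd
  let S : AddSubgroup A :=
    { carrier := {a | ∀ x y, φ (x * a) y = φ x (a * y)}
      zero_mem' := by intro x y; simp
      add_mem' := by
        intro a b ha hb x y
        simp only [Set.mem_ofPred_eq] at ha hb
        simp [mul_add, add_mul, ha, hb]
      neg_mem' := by
        intro a ha x y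
        simp only [Set.mem_ofPred_eq] at ha
        simp [ha] }
  have memS : ∀ a, a ∈ S ↔ ∀ x y, φ (x * a) y = φ x (a * y) := fun a => Iff.rfl
  have hmul : ∀ a b, a ∈ S → b ∈ S → a * b ∈ S := by
    intro a b ha hb x y
    rw [← mul_assoc, hb, ha, mul_assoc]
  have hid : ∀ g : A, g * g = g → g ∈ S := by
    intro g hg x y
    have h1 := h (x * g) ((1 - g) * y) (by
      have : g * (1 - g) = 0 := by rw [mul_sub, hg]; simp
      rw [mul_assoc, ← mul_assoc g, this]; simp)
    have h2 := h (x * (1 - g)) (g * y) (by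
      have : (1 - g) * g = 0 := by rw [sub_mul, hg]; simp
      rw [mul_assoc, ← mul_assoc (1 - g), this]; simp)
    simp only [sub_mul, mul_sub, one_mul, mul_one, map_sub, LinearMap.sub_apply] at h1 h2
    rw [sub_eq_zero] at h1 h2
    rw [h1, h2]
  have hoff : ∀ g : A, g * g = g → ∀ a, g * a * (1 - g) ∈ S := by
    intro g hg a
    have h0 : (1 - g) * g = 0 := by rw [sub_mul, hg]; simp
    have h3 : g + g * a * (1 - g) ∈ S := by
      apply hid
      have e1 : g * (g * a * (1 - g)) = g * a * (1 - g) := by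
        rw [← mul_assoc, ← mul_assoc, hg]
      have e2 : (g * a * (1 - g)) * g = 0 := by rw [mul_assoc, h0, mul_zero]
      have e3 : (g * a * (1 - g)) * (g * a * (1 - g)) = 0 := by
        calc (g * a * (1 - g)) * (g * a * (1 - g))
            = ((g * a * (1 - g)) * g) * (a * (1 - g)) := by simp only [mul_assoc]
          _ = 0 := by rw [e2, zero_mul]
      rw [add_mul, mul_add, mul_add, hg, e1, e2, e3]; simp
    have := S.sub_mem h3 (hid g hg)
    simpa using this
  have hf : (1 - e) * (1 - e) = 1 - e := by
    simp [mul_sub, sub_mul, he]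
  have hd : ∀ g : A, g * g = g → 1 - g ≠ 0 → ∀ a, g * a * g ∈ S := by
    intro g hg hg0 a
    have hf : (1 - g) * (1 - g) = 1 - g := by
      simp [mul_sub, sub_mul, hg]
    refine sandwich S g g (1 - g) hg0 ?_ a
    intro x y
    have h1 := hoff g hg x
    have h2 := hoff (1 - g) hf y
    rw [sub_sub_cancel] at h2
    have := hmul _ _ h1 h2
    have e : g * x * (1 - g) * ((1 - g) * y * g) = g * x * (1 - g) * y * g := by
      rw [← mul_assoc, ← mul_assoc, mul_assoc (g * x), hf]
    rwa [e] at this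
  have hall : a ∈ S := by
    have h1 := hoff e he a
    have h2 := hoff (1 - e) hf a
    rw [sub_sub_cancel] at h2
    have h3 := hd e he hf0 a
    have h4 := hd (1 - e) hf (by rwa [sub_sub_cancel]) a
    have := S.add_mem (S.add_mem h1 h2) (S.add_mem h3 h4)
    convert this using 1
    noncomm_ring
  have := hall 1 y
  simpa using this

lemma two_zpd_of_separable {F A : Type*} [Field F] [Ring A]
    [Algebra F A] [IsSimpleRing A] [FiniteDimensional F A]
    (hnd : ∃ a : A, a ≠ 0 ∧ ¬ IsUnit a) (hs : IsSeparableAlg F A) : Is2Zpd F A := by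
  intro φ h
  have h1 : ∀ x y w : A, x * y = 0 → φ y (w * x) = φ (y * w) x := by
    intro x y w hxy
    have key := zpd hnd (φ.compl₁₂ (LinearMap.mulLeft F y) (LinearMap.mulRight F x)) (by
      intro z w hzw
      simp only [LinearMap.compl₁₂_apply, LinearMap.mulLeft_apply, LinearMap.mulRight_apply]
      apply h
      · rw [mul_assoc, ← mul_assoc z, hzw]; simp
      · rw [mul_assoc, ← mul_assoc x, hxy]; simp)
    have := key w 1
    simpa using this.symm
  have h2 : ∀ x y w : A, φ y (w * x) - φ (y * w) x = φ 1 (w * (x * y)) - φ w (x * y) := by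
    intro x y w
    have key := zpd hnd ((φ.compl₁₂ LinearMap.id (LinearMap.mulLeft F w)).flip -
      (φ.compl₁₂ (LinearMap.mulRight F w) LinearMap.id).flip) (by
      intro x y hxy
      simp [h1 x y w hxy])
    have k1 := key x y
    have k2 := key (x * y) 1
    simp at k1 k2
    rw [k1, k2]
  let Δ : A →ₗ[F] A →ₗ[F] F := φ - (LinearMap.mul F A).compr₂ (φ 1)
  have hΔ : ∀ x y, Δ x y = φ x y - φ 1 (x * y) := fun x y => by simp [Δ]
  have hder : ∀ y w x, Δ (y * w) x = Δ y (w * x) + Δ w (x * y) := by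
    intro y w x
    have := h2 x y w
    simp only [hΔ, mul_assoc] at *
    linear_combination -this
  obtain ⟨m, p, q, hpq, hx⟩ := hs
  let f : A →ₗ[F] F := ∑ i, (Δ (p i)).comp (LinearMap.mulLeft F (q i))
  have hf : ∀ z, f z = ∑ i, Δ (p i) (q i * z) := fun z => by simp [f]
  have hin : ∀ x z, Δ x z = f (x * z) - f (z * x) := by
    intro x z
    have := congrArg (TensorProduct.lift (Δ.compl₂ (LinearMap.mulRight F z))) (hx x)
    simp only [map_sum, TensorProduct.lift.tmul, LinearMap.compl₂_apply,
      LinearMap.mulRight_apply, hder, Finset.sum_add_distrib] at this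
    rw [hf, hf]
    have e : ∑ i, Δ x (p i * (q i * z)) = Δ x z := by
      rw [← map_sum]
      simp only [← mul_assoc]
      rw [← Finset.sum_mul, hpq, one_mul]
    simp only [mul_assoc] at this
    rw [e] at this
    rw [← this]; ring
  refine ⟨φ 1 + f, -f, fun x y => ?_⟩
  have := hin x y
  rw [hΔ] at this
  simp
  linear_combination this

lemma exists_tmul_one_mem {Z B A : Type*} [Field Z] [Ring B] [Algebra Z B] [Ring A] [Algebra Z A]
    [Algebra.IsCentral Z A] [IsSimpleRing A] (I : TwoSidedIdeal (B ⊗[Z] A)) (w : B ⊗[Z] A)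
    (hw : w ∈ I) (hw0 : w ≠ 0) : ∃ b : B, b ≠ 0 ∧ b ⊗ₜ[Z] (1 : A) ∈ I := by
  classical
  let ℬ := Module.Basis.ofVectorSpace Z B
  let E := TensorProduct.equivFinsuppOfBasisLeft (N := A) ℬ
  have hE : ∀ (w : B ⊗[Z] A) (x y : A) i,
      E ((1 ⊗ₜ x) * w * (1 ⊗ₜ y)) i = x * E w i * y := by
    intro w x y i
    induction w using TensorProduct.induction_on with
    | zero => simp
    | tmul b a =>
      simp [E, TensorProduct.equivFinsuppOfBasisLeft_apply_tmul_apply]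
    | add u v hu hv =>
      simp only [mul_add, add_mul, map_add, Finsupp.add_apply, hu, hv]
  have main : ∀ n : ℕ, ∀ w ∈ I, w ≠ 0 → (E w).support.card = n →
      ∃ b : B, b ≠ 0 ∧ b ⊗ₜ[Z] (1 : A) ∈ I := by
    intro n
    induction n using Nat.strong_induction_on with
    | _ n ih =>
    intro w hw hw0 hn
    have hE0 : E w ≠ 0 := by simpa using hw0
    obtain ⟨i0, hi0⟩ := Finsupp.support_nonempty_iff.mpr hE0
    have hi0' := Finsupp.mem_support_iff.mp hi0
    let J : TwoSidedIdeal A := TwoSidedIdeal.mk'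
      {a | ∃ u ∈ I, (E u).support ⊆ (E w).support ∧ E u i0 = a}
      ⟨0, I.zero_mem, by simp, by simp⟩
      (by
        rintro a b ⟨u, hu, hus, rfl⟩ ⟨v, hv, hvs, rfl⟩
        refine ⟨u + v, I.add_mem hu hv, ?_, by simp⟩
        rw [map_add]
        exact Finsupp.support_add.trans (Finset.union_subset hus hvs))
      (by
        rintro a ⟨u, hu, hus, rfl⟩
        refine ⟨-u, I.neg_mem hu, ?_, by simp⟩
        rw [map_neg, Finsupp.support_neg]
        exact hus)
      (by
        rintro x a ⟨u, hu, hus, rfl⟩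
        refine ⟨(1 ⊗ₜ x) * u * (1 ⊗ₜ 1), I.mul_mem_right _ _ (I.mul_mem_left _ _ hu), ?_, ?_⟩
        · intro i hi
          apply hus
          rw [Finsupp.mem_support_iff] at *
          intro h
          apply hi
          rw [hE, h]; simp
        · rw [hE]; simp)
      (by
        rintro a x ⟨u, hu, hus, rfl⟩
        refine ⟨(1 ⊗ₜ 1) * u * (1 ⊗ₜ x), I.mul_mem_right _ _ (I.mul_mem_left _ _ hu), ?_, ?_⟩
        · intro i hi
          apply hus
          rw [Finsupp.mem_support_iff] at *
          intro h
          apply hi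
          rw [hE, h]; simp
        · rw [hE]; simp)
    have hJ : E w i0 ∈ J := by
      rw [TwoSidedIdeal.mem_mk']
      exact ⟨w, hw, subset_rfl, rfl⟩
    have h1 := IsSimpleRing.one_mem_of_ne_zero_mem J hi0' hJ
    rw [TwoSidedIdeal.mem_mk'] at h1
    obtain ⟨u, hu, hus, hu1⟩ := h1
    let c : A → B ⊗[Z] A := fun x => (1 ⊗ₜ x) * u * (1 ⊗ₜ 1) - (1 ⊗ₜ 1) * u * (1 ⊗ₜ x)
    have hc : ∀ x i, E (c x) i = x * E u i - E u i * x := by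
      intro x i
      simp only [c, map_sub, Finsupp.sub_apply, hE]; simp
    have hcI : ∀ x, c x ∈ I := fun x => I.sub_mem
      (I.mul_mem_right _ _ (I.mul_mem_left _ _ hu)) (I.mul_mem_right _ _ (I.mul_mem_left _ _ hu))
    by_cases hcz : ∀ x, c x = 0
    · have hz : ∀ i, ∃ z : Z, algebraMap Z A z = E u i := by
        intro i
        have : E u i ∈ Subalgebra.center Z A := by
          rw [Subalgebra.mem_center_iff]
          intro x
          have := hc x i
          rw [hcz x] at this
          simp only [map_zero, Finsupp.zero_apply] at this
          exact (sub_eq_zero.mp this.symm)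
        exact Algebra.mem_bot.mp (Algebra.IsCentral.out this)
      choose z hz using hz
      have hu' : u = (∑ i ∈ (E u).support, z i • ℬ i) ⊗ₜ[Z] (1 : A) := by
        have : u = E.symm (E u) := by simp
        conv_lhs => rw [this]
        simp only [E]
        rw [TensorProduct.equivFinsuppOfBasisLeft_symm_apply, TensorProduct.sum_tmul, Finsupp.sum]
        refine Finset.sum_congr rfl fun i _ => ?_
        change ℬ i ⊗ₜ[Z] (E u i) = _
        rw [← hz, Algebra.algebraMap_eq_smul_one, TensorProduct.smul_tmul]
      refine ⟨_, ?_, hu' ▸ hu⟩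
      intro h0
      rw [h0, TensorProduct.zero_tmul] at hu'
      rw [hu'] at hu1
      simp at hu1
    · push Not at hcz
      obtain ⟨x, hx⟩ := hcz
      refine ih _ ?_ (c x) (hcI x) hx rfl
      rw [← hn]
      apply Finset.card_lt_card
      refine (Finset.ssubset_iff_of_subset ?_).mpr ⟨i0, hi0, ?_⟩
      · intro i hi
        apply hus
        rw [Finsupp.mem_support_iff] at *
        intro h
        apply hi
        rw [hc, h]; simp
      · rw [Finsupp.notMem_support_iff, hc, hu1]; simp
  exact main _ w hw hw0 rfl

lemma tensor_simple {Z B A : Type*} [Field Z] [Ring B] [Algebra Z B] [Ring A] [Algebra Z A]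
    [Algebra.IsCentral Z A] [IsSimpleRing A] [IsSimpleRing B] : IsSimpleRing (B ⊗[Z] A) := by
  have : Nontrivial (B ⊗[Z] A) := inferInstance
  apply IsSimpleRing.of_eq_bot_or_eq_top
  intro I
  by_cases hI : I = ⊥
  · exact Or.inl hI
  right
  have : ∃ w ∈ I, w ≠ 0 := by
    by_contra h
    push Not at h
    apply hI
    ext x
    rw [TwoSidedIdeal.mem_bot]
    exact ⟨h x, fun hx => hx ▸ I.zero_mem⟩
  obtain ⟨w, hw, hw0⟩ := this
  obtain ⟨b, hb0, hb⟩ := exists_tmul_one_mem I w hw hw0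
  let J : TwoSidedIdeal B := TwoSidedIdeal.mk' {b | b ⊗ₜ[Z] (1 : A) ∈ I}
    (by simp [I.zero_mem])
    (by
      intro x y hx hy
      have := I.add_mem hx hy
      rw [← TensorProduct.add_tmul] at this
      exact this)
    (by
      intro x hx
      have := I.neg_mem hx
      rw [← TensorProduct.neg_tmul] at this
      exact this)
    (by
      intro x y hy
      have := I.mul_mem_left (x ⊗ₜ 1) _ hy
      simpa using this)
    (by
      intro x y hx
      have := I.mul_mem_right _ (y ⊗ₜ 1) hx
      simpa using this)
  have hJ : b ∈ J := by
    rw [TwoSidedIdeal.mem_mk']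
    exact hb
  have h1 := IsSimpleRing.one_mem_of_ne_zero_mem J hb0 hJ
  rw [TwoSidedIdeal.mem_mk'] at h1
  rw [← TwoSidedIdeal.one_mem_iff]
  exact h1

lemma central_separable {Z A : Type*} [Field Z] [Ring A] [Algebra Z A]
    [Algebra.IsCentral Z A] [IsSimpleRing A] [FiniteDimensional Z A] : IsSeparableAlg Z A := by
  have := tensor_simple (Z := Z) (B := A) (A := Aᵐᵒᵖ)
  have hinj : Function.Injective (AlgHom.mulLeftRight Z A) :=
    (AlgHom.mulLeftRight Z A).toRingHom.injective
  have hfin : Module.Finite Z Aᵐᵒᵖ := Module.Finite.equiv (MulOpposite.opLinearEquiv Z)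
  have hfr : Module.finrank Z (A ⊗[Z] Aᵐᵒᵖ) = Module.finrank Z (Module.End Z A) := by
    rw [Module.finrank_tensorProduct, Module.finrank_linearMap,
      (MulOpposite.opLinearEquiv Z : A ≃ₗ[Z] Aᵐᵒᵖ).finrank_eq]
  have hsurj : Function.Surjective (AlgHom.mulLeftRight Z A) :=
    (LinearMap.injective_iff_surjective_of_finrank_eq_finrank
      (f := (AlgHom.mulLeftRight Z A).toLinearMap) hfr).mp hinj
  obtain ⟨l, hl⟩ := LinearMap.exists_leftInverse_of_injective (Algebra.linearMap Z A)
    (LinearMap.ker_eq_bot.mpr (algebraMap Z A).injective)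
  have hl1 : l 1 = 1 := by
    have := LinearMap.congr_fun hl 1
    simpa using this
  obtain ⟨t, ht⟩ := hsurj ((Algebra.linearMap Z A).comp l)
  obtain ⟨m, p, q, rfl⟩ := TensorProduct.exists_sum_tmul_eq t
  have hs : ∀ a, ∑ i, p i * a * (q i).unop = algebraMap Z A (l a) := by
    intro a
    have := LinearMap.congr_fun ht a
    simpa [map_sum, LinearMap.sum_apply] using this
  refine ⟨m, p, fun i => (q i).unop, ?_, ?_⟩
  · have := hs 1
    simpa [hl1] using this
  · intro x
    have key : ∑ i, (x * p i) ⊗ₜ[Z] (q i) = ∑ i, p i ⊗ₜ[Z] (MulOpposite.op ((q i).unop * x)) := by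
      apply hinj
      ext a
      simp only [map_sum, LinearMap.sum_apply, AlgHom.mulLeftRight_apply, MulOpposite.unop_op]
      have e1 : ∑ i, x * p i * a * (q i).unop = x * ∑ i, p i * a * (q i).unop := by
        rw [Finset.mul_sum]; simp only [mul_assoc]
      have e2 : ∑ i, p i * a * ((q i).unop * x) = (∑ i, p i * a * (q i).unop) * x := by
        rw [Finset.sum_mul]; simp only [mul_assoc]
      rw [e1, e2, hs, Algebra.commutes]
    have := congrArg (TensorProduct.map LinearMap.id
      (MulOpposite.opLinearEquiv Z : A ≃ₗ[Z] Aᵐᵒᵖ).symm.toLinearMap) key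
    simpa [map_sum] using this

lemma exists_trace (Z A : Type*) [Field Z] [Ring A] [Algebra Z A]
    [Algebra.IsCentral Z A] [IsSimpleRing A] [FiniteDimensional Z A] :
    ∃ T : A →ₗ[Z] AlgebraicClosure Z, (∀ a, IsNilpotent a → T a = 0) ∧ ∃ a, T a ≠ 0 := by
  have := tensor_simple (Z := Z) (B := AlgebraicClosure Z) (A := A)
  obtain ⟨n, hn, ⟨g⟩⟩ := IsSimpleRing.exists_algEquiv_matrix_of_isAlgClosed (AlgebraicClosure Z)
    (AlgebraicClosure Z ⊗[Z] A)
  let T' : (AlgebraicClosure Z ⊗[Z] A) →ₗ[AlgebraicClosure Z] AlgebraicClosure Z :=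
    (Matrix.traceLinearMap (Fin n) (AlgebraicClosure Z) (AlgebraicClosure Z)).comp g.toLinearMap
  have hT' : ∀ w, T' w = (g w).trace := fun w => rfl
  let ι : A →ₐ[Z] (AlgebraicClosure Z ⊗[Z] A) := Algebra.TensorProduct.includeRight
  refine ⟨(T'.restrictScalars Z).comp ι.toLinearMap, ?_, ?_⟩
  · intro a ha
    change T' (ι a) = 0
    rw [hT']
    exact (Matrix.isNilpotent_trace_of_isNilpotent ((ha.map ι).map g)).eq_zero
  · by_contra h
    push Not at h
    have h' : ∀ a, T' (1 ⊗ₜ a) = 0 := h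
    have hz : ∀ w, T' w = 0 := by
      intro w
      induction w using TensorProduct.induction_on with
      | zero => simp
      | tmul k a =>
        have : k ⊗ₜ[Z] a = k • ((1 : AlgebraicClosure Z) ⊗ₜ[Z] a) := by
          rw [TensorProduct.smul_tmul']; simp
        rw [this, map_smul, h', smul_zero]
      | add u v hu hv => rw [map_add, hu, hv, add_zero]
    have := hz (g.symm (Matrix.single 0 0 1))
    rw [hT'] at this
    simp at this

lemma separable_of_fintype {F A ι : Type*} [Field F] [Ring A] [Algebra F A] [Fintype ι]
    (p q : ι → A) (h1 : ∑ i, p i * q i = 1)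
    (h2 : ∀ x : A, ∑ i, (x * p i) ⊗ₜ[F] q i = ∑ i, p i ⊗ₜ[F] (q i * x)) :
    IsSeparableAlg F A := by
  let e := (Fintype.equivFin ι).symm
  refine ⟨Fintype.card ι, p ∘ e, q ∘ e, ?_, fun x => ?_⟩
  · rw [← h1]
    exact e.sum_comp (fun i => p i * q i)
  · have a1 := e.sum_comp (fun i => (x * p i) ⊗ₜ[F] q i)
    have a2 := e.sum_comp (fun i => p i ⊗ₜ[F] (q i * x))
    simp only [Function.comp]
    rw [a1, a2, h2]

lemma separable_trans {F Z A : Type*} [Field F] [Field Z] [Ring A] [Algebra F Z] [Algebra Z A]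
    [Algebra F A] [IsScalarTower F Z A] (h1 : IsSeparableAlg F Z) (h2 : IsSeparableAlg Z A) :
    IsSeparableAlg F A := by
  obtain ⟨n, s, t, hst, hz⟩ := h1
  obtain ⟨m, p, q, hpq, hx⟩ := h2
  let al : Z →ₗ[F] A := (IsScalarTower.toAlgHom F Z A).toLinearMap
  have hal : ∀ z, al z = algebraMap Z A z := fun z => rfl
  let f : A →ₗ[F] A →ₗ[F] (A ⊗[F] A) := ∑ j, (TensorProduct.mk F A A).compl₁₂
    (LinearMap.mulRight F (al (s j))) (LinearMap.mulLeft F (al (t j)))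
  have hf : ∀ a b, f a b = ∑ j, (a * al (s j)) ⊗ₜ[F] (al (t j) * b) := by
    intro a b
    simp [f, LinearMap.sum_apply]
  let f' : A →+ A →+ (A ⊗[F] A) := AddMonoidHom.mk' (fun a => (f a).toAddMonoidHom) (by
    intro a b
    ext c
    simp)
  have hf' : ∀ a b, f' a b = f a b := fun a b => rfl
  let Ψ : A ⊗[Z] A →+ A ⊗[F] A := TensorProduct.liftAddHom f' (by
    intro z a b
    rw [hf', hf', hf, hf]
    have := congrArg (TensorProduct.map ((LinearMap.mulLeft F a).comp al)
      ((LinearMap.mulRight F b).comp al)) (hz z)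
    simp only [map_sum, TensorProduct.map_tmul, LinearMap.comp_apply, LinearMap.mulLeft_apply,
      LinearMap.mulRight_apply] at this
    simp only [hal, map_mul] at this ⊢
    have e1 : ∀ j, z • a * algebraMap Z A (s j) =
        a * (algebraMap Z A z * algebraMap Z A (s j)) := by
      intro j
      rw [Algebra.smul_def, Algebra.commutes, mul_assoc]
    have e2 : ∀ j, algebraMap Z A (t j) * z • b =
        algebraMap Z A (t j) * algebraMap Z A z * b := by
      intro j
      rw [Algebra.smul_def, mul_assoc]
    simp only [e1, e2]
    exact this)
  have hΨ : ∀ a b, Ψ (a ⊗ₜ b) = ∑ j, (a * al (s j)) ⊗ₜ[F] (al (t j) * b) := by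
    intro a b
    rw [← hf]
    rfl
  refine separable_of_fintype (ι := Fin m × Fin n) (fun k => p k.1 * al (s k.2))
    (fun k => al (t k.2) * q k.1) ?_ ?_
  · rw [Fintype.sum_prod_type]
    have : ∀ i, ∑ j, (p i * al (s j)) * (al (t j) * q i) = p i * q i := by
      intro i
      have e : ∑ j, al (s j) * al (t j) = 1 := by
        simp only [hal, ← map_mul, ← map_sum, hst, map_one]
      calc ∑ j, (p i * al (s j)) * (al (t j) * q i)
          = p i * (∑ j, al (s j) * al (t j)) * q i := by
            rw [Finset.mul_sum, Finset.sum_mul]; simp only [mul_assoc]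
        _ = _ := by rw [e, mul_one]
    simp only [this, hpq]
  · intro x
    rw [Fintype.sum_prod_type, Fintype.sum_prod_type]
    have := congrArg Ψ (hx x)
    simp only [map_sum, hΨ] at this
    simpa only [mul_assoc] using this

lemma extend_derivation {F Z A : Type*} [Field F] [Field Z] [Ring A] [Algebra F Z] [Algebra Z A]
    [Algebra F A] [IsScalarTower F Z A] [FiniteDimensional Z A] (h : IsSeparableAlg Z A)
    (δ : Derivation F Z Z) : ∃ D : A →ₗ[F] A, (∀ a b, D (a * b) = D a * b + a * D b) ∧
      ∀ z, D (algebraMap Z A z) = algebraMap Z A (δ z) := by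
  obtain ⟨m, p, q, hpq, hx⟩ := h
  let b := Module.finBasis Z A
  let d : A → A := fun a => ∑ i, δ (b.repr a i) • b i
  have dadd : ∀ x y, d (x + y) = d x + d y := by
    intro x y
    simp [d, add_smul, Finset.sum_add_distrib]
  have dsmul : ∀ (z : Z) x, d (z • x) = δ z • x + z • d x := by
    intro z x
    have e : δ z • x = ∑ i, δ z • b.repr x i • b i := by
      rw [← Finset.smul_sum, b.sum_repr]
    rw [e]
    simp only [d, map_smul, Finsupp.smul_apply, smul_eq_mul, Derivation.leibniz,
      Finset.smul_sum, smul_smul]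
    rw [← Finset.sum_add_distrib]
    refine Finset.sum_congr rfl fun i _ => ?_
    rw [← add_smul]
    congr 1
    ring
  let f : A →ₗ[Z] A →ₗ[Z] A := LinearMap.mk₂ Z (fun x y => d (x * y) - d x * y - x * d y)
    (by intro x x' y; simp only [add_mul, dadd]; abel)
    (by
      intro z x y
      simp only [smul_mul_assoc, dsmul, add_mul, smul_sub]; abel)
    (by intro x y y'; simp only [mul_add, dadd]; abel)
    (by
      intro z x y
      simp only [mul_smul_comm, dsmul, mul_add, smul_sub]; abel)
  have hf : ∀ x y, f x y = d (x * y) - d x * y - x * d y := fun x y => rfl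
  have cocycle : ∀ x y w, f (x * y) w = x * f y w + f x (y * w) - f x y * w := by
    intro x y w
    simp only [hf, mul_assoc, mul_sub, sub_mul]; abel
  let g : A →ₗ[Z] A := ∑ i, (LinearMap.mulLeft Z (p i)).comp (f (q i))
  have hg : ∀ x, g x = ∑ i, p i * f (q i) x := by
    intro x; simp [g, LinearMap.sum_apply]
  have hgf : ∀ x y, x * g y = f x y + g (x * y) - g x * y := by
    intro x y
    have := congrArg (TensorProduct.lift ((LinearMap.mul Z A).compl₂ (f.flip y))) (hx x)
    simp only [map_sum, TensorProduct.lift.tmul, LinearMap.compl₂_apply, LinearMap.mul_apply',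
      LinearMap.flip_apply, cocycle] at this
    rw [hg, hg, hg, Finset.mul_sum, Finset.sum_mul]
    simp only [← mul_assoc]
    rw [this]
    simp only [mul_add, mul_sub, Finset.sum_add_distrib, Finset.sum_sub_distrib, ← mul_assoc]
    rw [← Finset.sum_mul, hpq, one_mul]
  have Dsmul : ∀ (z : Z) x, d (z • x) + g (z • x) = δ z • x + z • (d x + g x) := by
    intro z x
    rw [dsmul, map_smul, smul_add, add_assoc]
  let D : A →ₗ[F] A :=
    { toFun := fun x => d x + g x
      map_add' := by
        intro x y
        simp only [dadd, map_add]; abel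
      map_smul' := by
        intro c x
        have := Dsmul (algebraMap F Z c) x
        simpa using this }
  have hD : ∀ x, D x = d x + g x := fun x => rfl
  have hder : ∀ x y, D (x * y) = D x * y + x * D y := by
    intro x y
    have e1 := hgf x y
    rw [hf] at e1
    simp only [hD, mul_add, add_mul, e1]
    abel
  refine ⟨D, hder, ?_⟩
  have h1 : D 1 = 0 := by
    have := hder 1 1
    simpa using this
  intro z
  have := Dsmul z 1
  rw [← hD, ← hD, h1, smul_zero, add_zero] at this
  rw [Algebra.algebraMap_eq_smul_one, this, Algebra.algebraMap_eq_smul_one]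

lemma derivation_zero {F Z A : Type*} [Field F] [Field Z] [Ring A] [Algebra F Z] [Algebra Z A]
    [Algebra F A] [IsScalarTower F Z A] [FiniteDimensional Z A]
    [Algebra.IsCentral Z A] [IsSimpleRing A] (h : Is2Zpd F A) (δ : Derivation F Z Z) (z : Z) :
    δ z = 0 := by
  obtain ⟨D, hD, hDz⟩ := extend_derivation (A := A) central_separable δ
  obtain ⟨T, hT, a, ha⟩ := exists_trace Z A
  let N : Submodule F A := Submodule.span F {a | IsNilpotent a}
  have hN : ∀ a ∈ N, T a = 0 := by
    intro a ha
    induction ha using Submodule.span_induction with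
    | mem x hx => exact hT x hx
    | zero => simp
    | add x y _ _ hx hy => rw [map_add, hx, hy, add_zero]
    | smul c x _ hx =>
      rw [← algebraMap_smul Z c x, map_smul, hx, smul_zero]
  have hlt : N < ⊤ := by
    rw [lt_top_iff_ne_top]
    intro h
    exact ha (hN a (h ▸ Submodule.mem_top))
  obtain ⟨τ, hτ0, hτ⟩ := Submodule.exists_le_ker_of_lt_top N hlt
  have hτn : ∀ a, IsNilpotent a → τ a = 0 := fun a ha => hτ (Submodule.subset_span ha)
  obtain ⟨τ₁, τ₂, h12⟩ := h (((LinearMap.mul F A).compr₂ τ).comp D) (by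
    intro x y hxy hyx
    change τ (D x * y) = 0
    apply hτn
    refine ⟨2, ?_⟩
    have h1 : D y * x + y * D x = 0 := by rw [← hD, hyx, map_zero]
    have h2 : y * D x = - (D y * x) := by
      rw [eq_neg_iff_add_eq_zero, add_comm, h1]
    calc (D x * y) ^ 2 = D x * (y * D x) * y := by rw [pow_two]; simp only [mul_assoc]
      _ = - (D x * D y * (x * y)) := by rw [h2]; simp only [mul_neg, neg_mul, mul_assoc]
      _ = 0 := by rw [hxy]; simp)
  have h12' : ∀ x y, τ (D x * y) = τ₁ (x * y) + τ₂ (y * x) := h12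
  have hD1 : D 1 = 0 := by
    have := hD 1 1
    simpa using this
  by_contra hz
  apply hτ0
  ext w
  have e1 := h12' 1 (algebraMap Z A z * (algebraMap Z A (δ z)⁻¹ * w))
  have e2 := h12' (algebraMap Z A z) (algebraMap Z A (δ z)⁻¹ * w)
  rw [hD1] at e1
  rw [hDz, ← mul_assoc, ← map_mul, mul_inv_cancel₀ hz, map_one, one_mul,
    ← Algebra.commutes z] at e2
  simp only [zero_mul, map_zero, one_mul, mul_one] at e1
  rw [e2, ← e1]; simp

lemma separable_of_two_zpd {F Z A : Type*} [Field F] [Field Z] [Ring A] [Algebra F Z] [Algebra Z A]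
    [Algebra F A] [IsScalarTower F Z A] [FiniteDimensional F A]
    [Algebra.IsCentral Z A] [IsSimpleRing A] (h : Is2Zpd F A) : IsSeparableAlg F A := by
  have hZA : FiniteDimensional Z A := FiniteDimensional.right F Z A
  have hFZ : FiniteDimensional F Z := FiniteDimensional.left F Z A
  refine separable_trans (Z := Z) ?_ central_separable
  have hu : Algebra.FormallyUnramified F Z := by
    constructor
    refine ⟨fun a b => ?_⟩
    rw [← sub_eq_zero, ← Module.forall_dual_apply_eq_zero_iff Z]
    intro f
    have h0 : f.compDer (KaehlerDifferential.D F Z) = 0 := by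
      ext z
      exact derivation_zero h _ z
    have := Derivation.liftKaehlerDifferential_comp (f.compDer (KaehlerDifferential.D F Z))
    have h2 : f = 0 := by
      apply Derivation.liftKaehlerDifferential_unique
      rw [h0]
      ext; simp
    rw [h2]; simp
  obtain ⟨m, p, q, hpq⟩ := TensorProduct.exists_sum_tmul_eq (Algebra.FormallyUnramified.elem F Z)
  have h1 := Algebra.FormallyUnramified.lmul_elem (R := F) (S := Z)
  have h2 := Algebra.FormallyUnramified.one_tmul_mul_elem (R := F) (S := Z)
  rw [hpq] at h1
  refine ⟨m, p, q, ?_, ?_⟩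
  · simpa [map_sum] using h1
  · intro x
    have := h2 x
    rw [hpq, Finset.mul_sum, Finset.mul_sum] at this
    simp only [Algebra.TensorProduct.tmul_mul_tmul, one_mul] at this
    rw [← this]
    simp only [mul_comm]

end TwoZpd

theorem simple_two_sided_zpd_iff_separable (F A : Type*) [Field F] [Ring A]
    [Algebra F A] [IsSimpleRing A] [FiniteDimensional F A]
    (hnd : ∃ a : A, a ≠ 0 ∧ ¬ IsUnit a) :
    Is2Zpd F A ↔ IsSeparableAlg F A := by
  refine ⟨fun h => ?_, TwoZpd.two_zpd_of_separable hnd⟩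
  have hf : IsField (Subalgebra.center F A) := IsSimpleRing.isField_center A
  let a1 : Algebra F (Subalgebra.center F A) := inferInstance
  let a2 : Algebra (Subalgebra.center F A) A :=
    (Subalgebra.center F A).val.toRingHom.toAlgebra'
      (fun c x => ((Subalgebra.mem_center_iff.mp c.2) x).symm)
  have a3 : IsScalarTower F (Subalgebra.center F A) A :=
    IsScalarTower.of_algebraMap_eq (fun _ => rfl)
  have a4 : Algebra.IsCentral (Subalgebra.center F A) A := by
    refine ⟨fun x hx => ?_⟩
    rw [Subalgebra.mem_center_iff] at hx
    exact Algebra.mem_bot.mpr ⟨⟨x, Subalgebra.mem_center_iff.mpr hx⟩, rfl⟩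
  exact @TwoZpd.separable_of_two_zpd F (Subalgebra.center F A) A _ hf.toField _ a1 a2 _ a3 _ a4 _ h
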